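/- Explicit action-Lipschitz bound for the continuation functional: suppose there is a constant L_ℓ ≥ 0 with |ℓ_i(θ,o) − ℓ_i(θ',o)| ≤ L_ℓ·d_Θ(θ,θ') for all i, o, θ, θ', and a constant η > 0 with ObsProb(o|b,θ) ≥ η for all b ∈ Δ_M, θ ∈ Θ, o ∈ O. Suppose W : Δ_M → ℝ is bounded with sup norm ‖W‖_∞ and is L-Lipschitz with respect to ‖·‖_∞. Then for every b ∈ Δ_M and all θ,θ' ∈ Θ, |G(b,θ;W) − G(b,θ';W)| ≤ K·d_Θ(θ,θ'), where K = |O|·[ L_ℓ·‖W‖_∞ + L·( L_ℓ/η + L_ℓ/η² ) ]. -/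

import Mathlib

open Finset ComplexOrder

/-- The belief simplex `Δ_M ⊆ ℝ^M`. -/
def simplex (M : ℕ) : Set (Fin M → ℝ) :=
  {b | (∀ i, 0 ≤ b i) ∧ ∑ i, b i = 1}

/-- The real number `Re Tr(E ρ)`, the Born-rule likelihood value. -/
noncomputable def trRe {d : ℕ} (E ρ : Matrix (Fin d) (Fin d) ℂ) : ℝ :=
  ((E * ρ).trace).re

/-- Observation probability `ObsProb(o | b, a) = Σ_j b j · Tr(E_o^{(a)} ρ_j)`. -/
noncomputable def obsProb {d M : ℕ} {O A : Type}
    (E : A → O → Matrix (Fin d) (Fin d) ℂ)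
    (ρ : Fin M → Matrix (Fin d) (Fin d) ℂ)
    (o : O) (b : Fin M → ℝ) (a : A) : ℝ :=
  ∑ j, b j * trRe (E a o) (ρ j)

/-- Bayesian posterior `τ(b,a,o)(i) = b i · Tr(E_o^{(a)} ρ_i) / ObsProb(o|b,a)`
(junk value when `ObsProb(o|b,a) = 0`, which only ever appears multiplied by a zero
observation probability). -/
noncomputable def bayes {d M : ℕ} {O A : Type}
    (E : A → O → Matrix (Fin d) (Fin d) ℂ)
    (ρ : Fin M → Matrix (Fin d) (Fin d) ℂ)
    (b : Fin M → ℝ) (a : A) (o : O) : Fin M → ℝ :=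
  fun i => b i * trRe (E a o) (ρ i) / obsProb E ρ o b a

/-- Stopping value `StopVal(b) = max_i b i`. -/
noncomputable def stopVal {M : ℕ} [NeZero M] (b : Fin M → ℝ) : ℝ :=
  univ.sup' univ_nonempty b

/-- Continuation functional
`G(b,θ;W) = −c_meas + Σ_o ObsProb(o|b,θ) · W(τ(b,θ,o))`
(outcomes with `ObsProb(o|b,θ) = 0` contribute zero). -/
noncomputable def contG {d M : ℕ} {O Θ : Type} [Fintype O]
    (E : Θ → O → Matrix (Fin d) (Fin d) ℂ)
    (ρ : Fin M → Matrix (Fin d) (Fin d) ℂ)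
    (c : ℝ) (b : Fin M → ℝ) (θ : Θ) (W : (Fin M → ℝ) → ℝ) : ℝ :=
  -c + ∑ o, obsProb E ρ o b θ * W (bayes E ρ b θ o)

open scoped MatrixOrder Matrix.Norms.L2Operator in
/-- The trace of a product of two positive semidefinite matrices has nonnegative real part. -/
lemma trRe_nonneg {d : ℕ} {A B : Matrix (Fin d) (Fin d) ℂ}
    (hA : A.PosSemidef) (hB : B.PosSemidef) : 0 ≤ trRe A B := by
  obtain ⟨C, rfl⟩ := CStarAlgebra.nonneg_iff_eq_star_mul_self.mp hB.nonneg
  have h := (hA.mul_mul_conjTranspose_same C).trace_nonneg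
  rw [mul_assoc, Matrix.trace_mul_comm, mul_assoc] at h
  exact (Complex.le_def.mp h).1

lemma sum_trRe {d : ℕ} {O : Type} [Fintype O] (E : O → Matrix (Fin d) (Fin d) ℂ)
    (hE : ∑ o, E o = 1) {ρ : Matrix (Fin d) (Fin d) ℂ} (hρ : ρ.trace = 1) :
    ∑ o, trRe (E o) ρ = 1 := by
  simp only [trRe]
  rw [← Complex.re_sum, ← Matrix.trace_sum, ← Finset.sum_mul, hE, one_mul, hρ, Complex.one_re]

section Belief

variable {d M : ℕ} {O Θ : Type} {E : Θ → O → Matrix (Fin d) (Fin d) ℂ}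
  {ρ : Fin M → Matrix (Fin d) (Fin d) ℂ} {b : Fin M → ℝ} {θ θ' : Θ} {o : O}

lemma obsProb_le_one (hb : b ∈ simplex M) (h : ∀ i, trRe (E θ o) (ρ i) ≤ 1) :
    obsProb E ρ o b θ ≤ 1 := by
  calc obsProb E ρ o b θ ≤ ∑ i, b i :=
        Finset.sum_le_sum fun i _ => mul_le_of_le_one_right (hb.1 i) (h i)
    _ = 1 := hb.2

lemma bayes_mem_simplex (hb : b ∈ simplex M) (h : ∀ i, 0 ≤ trRe (E θ o) (ρ i))
    (hp : 0 < obsProb E ρ o b θ) : bayes E ρ b θ o ∈ simplex M := by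
  refine ⟨fun i => div_nonneg (mul_nonneg (hb.1 i) (h i)) hp.le, ?_⟩
  simp only [bayes]
  rw [← Finset.sum_div]
  exact div_self hp.ne'

lemma abs_obsProb_sub_le {δ : ℝ} (hb : b ∈ simplex M)
    (h : ∀ i, |trRe (E θ o) (ρ i) - trRe (E θ' o) (ρ i)| ≤ δ) :
    |obsProb E ρ o b θ - obsProb E ρ o b θ'| ≤ δ := by
  rw [obsProb, obsProb, ← Finset.sum_sub_distrib]
  calc |∑ i, (b i * trRe (E θ o) (ρ i) - b i * trRe (E θ' o) (ρ i))|
      ≤ ∑ i, b i * δ := (Finset.abs_sum_le_sum_abs _ _).trans <|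
        Finset.sum_le_sum fun i _ => by
          rw [← mul_sub, abs_mul, abs_of_nonneg (hb.1 i)]
          exact mul_le_mul_of_nonneg_left (h i) (hb.1 i)
    _ = δ := by rw [← Finset.sum_mul, hb.2, one_mul]

lemma obsProb_mul_norm_bayes_sub_le {δ : ℝ} (hb : b ∈ simplex M) (hδ : 0 ≤ δ)
    (h : ∀ i, |trRe (E θ o) (ρ i) - trRe (E θ' o) (ρ i)| ≤ δ)
    (hnn : ∀ i, 0 ≤ trRe (E θ' o) (ρ i))
    (hp : 0 < obsProb E ρ o b θ) (hp' : 0 < obsProb E ρ o b θ') :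
    obsProb E ρ o b θ * ‖bayes E ρ b θ o - bayes E ρ b θ' o‖ ≤ 2 * δ := by
  rw [mul_comm, ← le_div_iff₀ hp, pi_norm_le_iff_of_nonneg (by positivity)]
  intro i
  have hb1 : b i ≤ 1 := hb.2 ▸ Finset.single_le_sum (fun j _ => hb.1 j) (Finset.mem_univ i)
  have ht := bayes_mem_simplex hb hnn hp'
  have ht1 : bayes E ρ b θ' o i ≤ 1 :=
    ht.2 ▸ Finset.single_le_sum (fun j _ => ht.1 j) (Finset.mem_univ i)
  have key : bayes E ρ b θ o i - bayes E ρ b θ' o i =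
      (b i * (trRe (E θ o) (ρ i) - trRe (E θ' o) (ρ i)) -
        bayes E ρ b θ' o i * (obsProb E ρ o b θ - obsProb E ρ o b θ')) / obsProb E ρ o b θ := by
    simp only [bayes]
    field_simp
    ring
  rw [Pi.sub_apply, Real.norm_eq_abs, key, abs_div, abs_of_pos hp]
  gcongr
  refine (abs_sub _ _).trans ?_
  rw [abs_mul, abs_mul, abs_of_nonneg (hb.1 i), abs_of_nonneg (ht.1 i), two_mul]
  exact add_le_add ((mul_le_of_le_one_left (abs_nonneg _) hb1).trans (h i))
    ((mul_le_of_le_one_left (abs_nonneg _) ht1).trans (abs_obsProb_sub_le hb h))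

end Belief

/-- Explicit action-Lipschitz bound for the continuation functional: if each likelihood
is `L_ℓ`-Lipschitz in `θ`, `ObsProb(o|b,θ) ≥ η > 0` on the simplex, and `W` is bounded
by `‖W‖_∞` and `L`-Lipschitz w.r.t. `‖·‖_∞` on the simplex, then for every `b ∈ Δ_M`
and all `θ, θ'`, `|G(b,θ;W) − G(b,θ';W)| ≤ K · d_Θ(θ,θ')` with
`K = |O| · (L_ℓ·‖W‖_∞ + L·(L_ℓ/η + L_ℓ/η²))`. -/
theorem continuation_action_lipschitz
    (d M : ℕ) (hd : 0 < d) [NeZero M]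
    (O : Type) [Fintype O] [Nonempty O]
    (Θ : Type) [MetricSpace Θ]
    (ρ : Fin M → Matrix (Fin d) (Fin d) ℂ)
    (hρpsd : ∀ i, (ρ i).PosSemidef) (hρtr : ∀ i, (ρ i).trace = 1)
    (E : Θ → O → Matrix (Fin d) (Fin d) ℂ)
    (hEpsd : ∀ θ o, (E θ o).PosSemidef) (hEsum : ∀ θ, ∑ o, E θ o = 1)
    (Lℓ : ℝ) (hLℓ : 0 ≤ Lℓ)
    (hLik : ∀ (i : Fin M) (o : O) (θ θ' : Θ),
      |trRe (E θ o) (ρ i) - trRe (E θ' o) (ρ i)| ≤ Lℓ * dist θ θ')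
    (η : ℝ) (hη : 0 < η)
    (hηlb : ∀ b ∈ simplex M, ∀ (θ : Θ) (o : O), η ≤ obsProb E ρ o b θ)
    (c : ℝ)
    (W : (Fin M → ℝ) → ℝ) (Wn : ℝ) (hWn : ∀ b ∈ simplex M, |W b| ≤ Wn)
    (L : ℝ) (hL : 0 ≤ L)
    (hWLip : ∀ x ∈ simplex M, ∀ y ∈ simplex M, |W x - W y| ≤ L * ‖x - y‖) :
    ∀ b ∈ simplex M, ∀ (θ θ' : Θ),
      |contG E ρ c b θ W - contG E ρ c b θ' W|
        ≤ (Fintype.card O : ℝ) * (Lℓ * Wn + L * (Lℓ / η + Lℓ / η ^ 2)) * dist θ θ' := by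
  intro b hb θ θ'
  have hnn θ o i : 0 ≤ trRe (E θ o) (ρ i) := trRe_nonneg (hEpsd θ o) (hρpsd i)
  have hle θ o i : trRe (E θ o) (ρ i) ≤ 1 :=
    sum_trRe (E θ) (hEsum θ) (hρtr i) ▸
      Finset.single_le_sum (fun o _ => hnn θ o i) (Finset.mem_univ o)
  have hpos θ o : 0 < obsProb E ρ o b θ := hη.trans_le (hηlb b hb θ o)
  have hη1 : η ≤ 1 :=
    (hηlb b hb θ (Classical.arbitrary O)).trans (obsProb_le_one hb (hle θ _))
  have hδ : 0 ≤ Lℓ * dist θ θ' := by positivity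
  have hconst : 2 * (Lℓ * dist θ θ') ≤ (Lℓ / η + Lℓ / η ^ 2) * dist θ θ' := by
    have h1 : Lℓ ≤ Lℓ / η := le_div_self hLℓ hη hη1
    have h2 : Lℓ ≤ Lℓ / η ^ 2 := le_div_self hLℓ (by positivity) (pow_le_one₀ hη.le hη1)
    calc 2 * (Lℓ * dist θ θ') = (Lℓ + Lℓ) * dist θ θ' := by ring
      _ ≤ _ := by gcongr
  have hterm (o : O) : |obsProb E ρ o b θ * W (bayes E ρ b θ o) -
      obsProb E ρ o b θ' * W (bayes E ρ b θ' o)| ≤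
      (Lℓ * Wn + L * (Lℓ / η + Lℓ / η ^ 2)) * dist θ θ' := by
    have hLik' i := hLik i o θ θ'
    have ht := bayes_mem_simplex hb (hnn θ o) (hpos θ o)
    have ht' := bayes_mem_simplex hb (hnn θ' o) (hpos θ' o)
    calc |obsProb E ρ o b θ * W (bayes E ρ b θ o) - obsProb E ρ o b θ' * W (bayes E ρ b θ' o)|
        = |(obsProb E ρ o b θ - obsProb E ρ o b θ') * W (bayes E ρ b θ' o) +
            obsProb E ρ o b θ * (W (bayes E ρ b θ o) - W (bayes E ρ b θ' o))| := by
          congr 1; ring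
      _ ≤ |obsProb E ρ o b θ - obsProb E ρ o b θ'| * |W (bayes E ρ b θ' o)| +
            obsProb E ρ o b θ * |W (bayes E ρ b θ o) - W (bayes E ρ b θ' o)| := by
          refine (abs_add_le _ _).trans_eq ?_
          rw [abs_mul, abs_mul, abs_of_pos (hpos θ o)]
      _ ≤ Lℓ * dist θ θ' * Wn + obsProb E ρ o b θ *
            (L * ‖bayes E ρ b θ o - bayes E ρ b θ' o‖) :=
          add_le_add
            (mul_le_mul (abs_obsProb_sub_le hb hLik') (hWn _ ht') (abs_nonneg _) hδ)
            (mul_le_mul_of_nonneg_left (hWLip _ ht _ ht') (hpos θ o).le)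
      _ = Lℓ * dist θ θ' * Wn + L *
            (obsProb E ρ o b θ * ‖bayes E ρ b θ o - bayes E ρ b θ' o‖) := by ring
      _ ≤ Lℓ * dist θ θ' * Wn + L * ((Lℓ / η + Lℓ / η ^ 2) * dist θ θ') := by
          refine add_le_add le_rfl (mul_le_mul_of_nonneg_left ?_ hL)
          exact (obsProb_mul_norm_bayes_sub_le hb hδ hLik' (hnn θ' o)
            (hpos θ o) (hpos θ' o)).trans hconst
      _ = (Lℓ * Wn + L * (Lℓ / η + Lℓ / η ^ 2)) * dist θ θ' := by ring
  rw [contG, contG, add_sub_add_left_eq_sub, ← Finset.sum_sub_distrib]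
  refine (Finset.abs_sum_le_sum_abs _ _).trans ((Finset.sum_le_sum fun o _ => hterm o).trans_eq ?_)
  rw [Finset.sum_const, Finset.card_univ, nsmul_eq_mul, mul_assoc]
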